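/- Let A ∈ ℝ^{m×n} be non-degenerate. Then for every h ∈ ℝ^m one has ‖Σ(A)⁻¹P⁽²⁾(A)·h‖_∞ ≤ ‖h‖_∞ and ‖Σ(A)⁻¹P⁽²⁾(A)·h‖_{σ(A)} ≤ ‖h‖_{σ(A)}; that is, the matrix Σ(A)⁻¹P⁽²⁾(A) is a contraction both in the ℓ∞ norm and in the σ(A)-weighted Euclidean norm. -/

import Mathlib

open Matrix Finset

/-- The orthogonal projection matrix `P(B) = B(BᵀB)⁻¹Bᵀ` onto the image of `B`. -/
noncomputable def projMat {m n : ℕ} (B : Matrix (Fin m) (Fin n) ℝ) :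
    Matrix (Fin m) (Fin m) ℝ :=
  B * (Bᵀ * B)⁻¹ * Bᵀ

/-- The entrywise (Hadamard) square `P⁽²⁾(B) = P(B) ∘ P(B)`. -/
noncomputable def projSq {m n : ℕ} (B : Matrix (Fin m) (Fin n) ℝ) :
    Matrix (Fin m) (Fin m) ℝ :=
  Matrix.hadamard (projMat B) (projMat B)

/-- The leverage scores `σ(B)ᵢ = P(B)ᵢᵢ`. -/
noncomputable def lev {m n : ℕ} (B : Matrix (Fin m) (Fin n) ℝ) (i : Fin m) : ℝ :=
  projMat B i i

theorem projMat_transpose {m n : ℕ} (B : Matrix (Fin m) (Fin n) ℝ) :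
    (projMat B)ᵀ = projMat B := by
  simp [projMat, Matrix.transpose_mul, Matrix.transpose_nonsing_inv, Matrix.mul_assoc]

/-- Idempotence needs no rank hypothesis: if `BᵀB` is singular, its `Matrix.inv` is `0`. -/
theorem projMat_mul_self {m n : ℕ} (B : Matrix (Fin m) (Fin n) ℝ) :
    projMat B * projMat B = projMat B := by
  by_cases hu : IsUnit (Bᵀ * B).det
  · calc projMat B * projMat B
        = B * ((Bᵀ * B)⁻¹ * (Bᵀ * B)) * (Bᵀ * B)⁻¹ * Bᵀ := by
          simp only [projMat, Matrix.mul_assoc]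
      _ = projMat B := by rw [Matrix.nonsing_inv_mul _ hu, Matrix.mul_one, projMat]
  · simp [projMat, Matrix.nonsing_inv_apply_not_isUnit _ hu]

theorem sum_projMat_sq_row {m n : ℕ} (B : Matrix (Fin m) (Fin n) ℝ)
    (i : Fin m) : ∑ j, projMat B i j ^ 2 = lev B i := by
  conv_rhs => rw [lev, ← projMat_mul_self B, Matrix.mul_apply]
  refine Finset.sum_congr rfl fun j _ => ?_
  rw [sq, ← congrFun₂ (projMat_transpose B) j i, Matrix.transpose_apply]

theorem sum_projMat_sq_col {m n : ℕ} (B : Matrix (Fin m) (Fin n) ℝ)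
    (j : Fin m) : ∑ i, projMat B i j ^ 2 = lev B j := by
  rw [← sum_projMat_sq_row B j]
  refine Finset.sum_congr rfl fun i _ => ?_
  rw [← congrFun₂ (projMat_transpose B) i j, Matrix.transpose_apply]

theorem lev_nonneg {m n : ℕ} (B : Matrix (Fin m) (Fin n) ℝ) (i : Fin m) :
    0 ≤ lev B i := by
  rw [← sum_projMat_sq_row B i]
  positivity

theorem diagonal_lev_inv_mul_projSq_mulVec {m n : ℕ} (B : Matrix (Fin m) (Fin n) ℝ)
    (h : Fin m → ℝ) (i : Fin m) :
    ((Matrix.diagonal (fun i => (lev B i)⁻¹) * projSq B) *ᵥ h) i =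
      (lev B i)⁻¹ * ∑ j, projMat B i j ^ 2 * h j := by
  rw [← Matrix.mulVec_mulVec, Matrix.mulVec_diagonal]
  simp [Matrix.mulVec, dotProduct, projSq, sq]

/-- **`Σ(A)⁻¹P⁽²⁾(A)` is a contraction.**  For non-degenerate `A` and every `h`,
`‖Σ(A)⁻¹P⁽²⁾(A)h‖_∞ ≤ ‖h‖_∞` and `‖Σ(A)⁻¹P⁽²⁾(A)h‖_{σ(A)} ≤ ‖h‖_{σ(A)}`.
(Here `‖·‖` on `Fin m → ℝ` is the sup norm.) -/
theorem sigma_inv_p2_contraction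
    {m n : ℕ} (A : Matrix (Fin m) (Fin n) ℝ) (hrank : A.rank = n) (hrows : ∀ i, A i ≠ 0)
    (h : Fin m → ℝ) :
    ‖(Matrix.diagonal (fun i => (lev A i)⁻¹) * projSq A) *ᵥ h‖ ≤ ‖h‖ ∧
    Real.sqrt (∑ i, lev A i *
        (((Matrix.diagonal (fun i => (lev A i)⁻¹) * projSq A) *ᵥ h) i) ^ 2) ≤
      Real.sqrt (∑ i, lev A i * h i ^ 2) := by
  have hσ := lev_nonneg A
  constructor
  · refine (pi_norm_le_iff_of_nonneg (norm_nonneg h)).2 fun i => ?_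
    rw [diagonal_lev_inv_mul_projSq_mulVec, norm_mul, norm_inv, Real.norm_of_nonneg (hσ i)]
    have hsum : ‖∑ j, projMat A i j ^ 2 * h j‖ ≤ lev A i * ‖h‖ := by
      rw [← sum_projMat_sq_row A i, Finset.sum_mul]
      refine norm_sum_le_of_le _ fun j _ => ?_
      rw [norm_mul, Real.norm_of_nonneg (sq_nonneg _)]
      gcongr
      exact norm_le_pi_norm h j
    exact inv_mul_le_of_le_mul₀ (hσ i) (norm_nonneg h) hsum
  · apply Real.sqrt_le_sqrt
    calc ∑ i, lev A i * (((Matrix.diagonal (fun i => (lev A i)⁻¹) * projSq A) *ᵥ h) i) ^ 2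
        ≤ ∑ i, ∑ j, projMat A i j ^ 2 * h j ^ 2 := by
          refine Finset.sum_le_sum fun i _ => ?_
          rw [diagonal_lev_inv_mul_projSq_mulVec]
          have hcs : (∑ j, projMat A i j ^ 2 * h j) ^ 2 ≤
              lev A i * ∑ j, projMat A i j ^ 2 * h j ^ 2 := by
            rw [← sum_projMat_sq_row A i]
            exact Finset.sum_sq_le_sum_mul_sum_of_sq_le_mul _ (fun j _ => sq_nonneg _)
              (fun j _ => by positivity) fun j _ => le_of_eq (by ring)
          have hnonneg : 0 ≤ ∑ j, projMat A i j ^ 2 * h j ^ 2 := by positivity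
          rcases (hσ i).eq_or_lt with h0 | hpos
          · rwa [← h0, zero_mul]
          · rw [mul_pow, ← mul_assoc, sq (lev A i)⁻¹, mul_inv_cancel_left₀ hpos.ne']
            exact inv_mul_le_of_le_mul₀ (hσ i) hnonneg hcs
      _ = ∑ i, lev A i * h i ^ 2 := by
          rw [Finset.sum_comm]
          simp only [← Finset.sum_mul, sum_projMat_sq_col A]
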